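/- Let m ≥ 5 be an odd integer and set n' = 2^{m−1} − 3·2^{(m−1)/2}. Then there exists a binary linear code C' (q = 2) with parameters [2^m + n' − 1, 2m, 2^{m−1} − 2^{(m−1)/2}]_2 that is a minimal code violating the Ashikhmin-Barg condition, and whose weight distribution is given as follows: for every integer w, A_w(C') equals the sum of the counts c over all pairs (v, c) with v = w in the list L = { (0, 1), (2^{m−1} − 2^{(m−1)/2}, (2^{m−1} + 2^{(m−1)/2} − 1)·(2^{m−2} + 2^{(m−3)/2})), (2^{m−1}, (2^{m−1} − 1)·(2^{m−1} + 1)), (2^{m−1} + 2^{(m−1)/2}, (2^{m−1} − 2^{(m−1)/2} − 1)·(2^{m−2} − 2^{(m−3)/2})), (2^m − 2^{(m+3)/2}, (2^{m−1} − 2^{(m−1)/2})·(2^{m−2} + 2^{(m−3)/2})), (2^m − 3·2^{(m−1)/2}, 2^{m−1}·(2^{m−1} + 1)), (2^m − 2^{(m+1)/2}, (2^{m−1} + 2^{(m−1)/2})·(2^{m−2} − 2^{(m−3)/2})) }; in particular A_w(C') = 0 if w is not among the listed values v. -/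

import Mathlib

open Finset BigOperators

/-- Ceiling division on naturals: `cdiv a b = ⌈a / b⌉`. -/
def cdiv (a b : ℕ) : ℕ := (a + b - 1) / b

/-- The minimum Hamming weight of a nonzero codeword of a linear code. -/
noncomputable def wmin {F : Type} [Field F] [Fintype F] [DecidableEq F] {n : ℕ}
    (C : Submodule F (Fin n → F)) : ℕ :=
  sInf {w | ∃ c ∈ C, c ≠ (0 : Fin n → F) ∧ hammingNorm c = w}

/-- The maximum Hamming weight of a codeword of a linear code. -/
noncomputable def wmax {F : Type} [Field F] [Fintype F] [DecidableEq F] {n : ℕ}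
    (C : Submodule F (Fin n → F)) : ℕ :=
  sSup {w | ∃ c ∈ C, hammingNorm c = w}

/-- A linear code is minimal if every nonzero codeword `c` is minimal: any codeword `c'`
whose support is contained in the support of `c` is a scalar multiple of `c`. -/
def IsMinimalCode {F : Type} [Field F] [Fintype F] [DecidableEq F] {n : ℕ}
    (C : Submodule F (Fin n → F)) : Prop :=
  ∀ c ∈ C, c ≠ (0 : Fin n → F) → ∀ c' ∈ C,
    {i : Fin n | c' i ≠ 0} ⊆ {i : Fin n | c i ≠ 0} → ∃ l : F, c' = l • c

/-- A linear code is self-orthogonal if the standard inner product of any two codewords is 0. -/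
def SelfOrthogonal {F : Type} [Field F] {n : ℕ} (C : Submodule F (Fin n → F)) : Prop :=
  ∀ c ∈ C, ∀ c' ∈ C, ∑ i, c i * c' i = 0

/-- A linear `[n,k]_q` code is projective if it is the image of `x ↦ (x·g_1, …, x·g_n)` for
nonzero, pairwise linearly independent vectors `g_1, …, g_n ∈ F_q^k`. -/
def IsProjectiveCode {F : Type} [Field F] {n : ℕ} (k : ℕ) (C : Submodule F (Fin n → F)) : Prop :=
  ∃ g : Fin n → (Fin k → F),
    (∀ i, g i ≠ 0) ∧
    (∀ i j, i ≠ j → ∀ l : F, g i ≠ l • g j) ∧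
    (C : Set (Fin n → F)) = {c | ∃ x : Fin k → F, c = fun i => ∑ t, x t * g i t}

/-- `Aw C w` is the number of codewords of `C` of Hamming weight `w`. -/
noncomputable def Aw {F : Type} [Field F] [Fintype F] [DecidableEq F] {n : ℕ}
    (C : Submodule F (Fin n → F)) (w : ℕ) : ℕ :=
  Set.ncard {c : Fin n → F | c ∈ C ∧ hammingNorm c = w}

/-- The sign character `t ↦ (-1)^t` of `ZMod 2`. -/
def binarySign (t : ZMod 2) : ℤ := if t = 0 then 1 else -1

theorem binarySign_zero : binarySign 0 = 1 := rfl

theorem binarySign_add (s t : ZMod 2) :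
    binarySign (s + t) = binarySign s * binarySign t := by
  revert s t; decide

theorem binarySign_eq_or (t : ZMod 2) : binarySign t = 1 ∨ binarySign t = -1 := by
  revert t; decide

section GoldForm

variable {F : Type} [Field F] [Algebra (ZMod 2) F]

/-- The trace form `x ↦ Tr (a x + b x³)` attached to the pair `p = (a, b)`, as a linear function
of `p`. -/
noncomputable def goldForm (x : F) : F × F →ₗ[ZMod 2] ZMod 2 :=
  Algebra.trace (ZMod 2) F ∘ₗ
    (LinearMap.mulRight (ZMod 2) x).coprod (LinearMap.mulRight (ZMod 2) (x ^ 3))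

theorem goldForm_apply (x : F) (p : F × F) :
    goldForm x p = Algebra.trace (ZMod 2) F (p.1 * x + p.2 * x ^ 3) := by
  simp [goldForm]

theorem goldForm_zero_left (p : F × F) : goldForm (0 : F) p = 0 := by
  simp [goldForm_apply]

variable [Fintype F]

/-- The Walsh sum `∑ x, (-1)^Tr (a x + b x³)` at the pair `p = (a, b)`. -/
noncomputable def goldWalsh (p : F × F) : ℤ := ∑ x : F, binarySign (goldForm x p)

theorem goldWalsh_zero : goldWalsh (0 : F × F) = Fintype.card F := by
  simp [goldWalsh, binarySign_zero]

theorem trace_sq (x : F) :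
    Algebra.trace (ZMod 2) F (x ^ 2) = Algebra.trace (ZMod 2) F x := by
  have h := Algebra.trace_eq_of_algEquiv (FiniteField.frobeniusAlgEquivOfAlgebraic (ZMod 2) F) x
  simpa [ZMod.card] using h

theorem goldWalsh_eq_of_support_subset {p p' : F × F}
    (h : ∀ x : F, goldForm x p' ≠ 0 → goldForm x p ≠ 0) :
    goldWalsh p = goldWalsh p' + goldWalsh (p - p') - Fintype.card F := by
  have hsign : ∀ s t : ZMod 2, (t ≠ 0 → s ≠ 0) →
      binarySign s = binarySign t + binarySign (s - t) - 1 := by decide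
  simp only [goldWalsh, map_sub]
  rw [Finset.sum_congr rfl fun x _ => hsign _ _ (h x), Finset.sum_sub_distrib,
    Finset.sum_add_distrib]
  simp

variable [DecidableEq F]

theorem sum_binarySign_trace_mul (a : F) :
    ∑ x : F, binarySign (Algebra.trace (ZMod 2) F (a * x)) =
      if a = 0 then (Fintype.card F : ℤ) else 0 := by
  split_ifs with ha
  · simp [ha, binarySign_zero]
  · obtain ⟨y, hy⟩ := Algebra.trace_surjective (ZMod 2) F 1
    have h : ∑ x : F, binarySign (Algebra.trace (ZMod 2) F (a * x)) =
        ∑ x : F, -binarySign (Algebra.trace (ZMod 2) F (a * x)) := by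
      rw [← Equiv.sum_comp (Equiv.addRight (a⁻¹ * y))]
      refine Finset.sum_congr rfl fun x _ => ?_
      rw [Equiv.coe_addRight, mul_add, mul_inv_cancel_left₀ ha, map_add, hy, binarySign_add]
      simp [binarySign]
    rw [Finset.sum_neg_distrib] at h
    omega

theorem sum_binarySign_trace_pair (u v : F) :
    ∑ p : F × F, binarySign (Algebra.trace (ZMod 2) F (p.1 * u + p.2 * v)) =
      if u = 0 ∧ v = 0 then (Fintype.card F : ℤ) ^ 2 else 0 := by
  simp_rw [map_add, binarySign_add, mul_comm _ u, mul_comm _ v]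
  rw [Fintype.sum_prod_type]
  simp_rw [← Finset.mul_sum, ← Finset.sum_mul, sum_binarySign_trace_mul]
  split_ifs <;> simp_all [sq]

theorem goldWalsh_sq (p : F × F) :
    goldWalsh p ^ 2 = Fintype.card F *
      ∑ z : F, if p.2 * z + p.2 ^ 2 * z ^ 4 = 0 then binarySign (goldForm z p) else 0 := by
  have : CharP F 2 := charP_of_injective_algebraMap (algebraMap (ZMod 2) F).injective 2
  have h2 : (2 : F) = 0 := CharTwo.two_eq_zero
  have hsq : Function.Bijective fun x : F => x ^ 2 := by
    refine Finite.injective_iff_bijective.mp fun x y h => ?_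
    exact frobenius_inj F 2 h
  calc goldWalsh p ^ 2
      = ∑ x : F, ∑ y : F, binarySign (goldForm x p) * binarySign (goldForm y p) := by
        rw [sq, goldWalsh, Finset.sum_mul_sum]
    _ = ∑ x : F, ∑ z : F, binarySign (goldForm x p) * binarySign (goldForm (x + z) p) :=
        Finset.sum_congr rfl fun x _ => (Equiv.sum_comp (Equiv.addLeft x) _).symm
    _ = ∑ z : F, ∑ x : F, binarySign (goldForm z p) *
          binarySign (Algebra.trace (ZMod 2) F ((p.2 * z + p.2 ^ 2 * z ^ 4) * x ^ 2)) := by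
        rw [Finset.sum_comm]
        refine Finset.sum_congr rfl fun z _ => Finset.sum_congr rfl fun x _ => ?_
        rw [← binarySign_add, ← binarySign_add]
        congr 1
        have h : Algebra.trace (ZMod 2) F ((p.2 * z + p.2 ^ 2 * z ^ 4) * x ^ 2) =
            Algebra.trace (ZMod 2) F (p.2 * z * x ^ 2 + p.2 * z ^ 2 * x) := by
          rw [map_add, ← trace_sq (p.2 * z ^ 2 * x), ← map_add]
          congr 1; ring
        rw [h]
        simp only [goldForm_apply, ← map_add]
        congr 1
        linear_combination (p.1 * x + p.2 * x ^ 3 + p.2 * x ^ 2 * z + p.2 * x * z ^ 2) * h2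
    _ = _ := by
        rw [Finset.mul_sum]
        refine Finset.sum_congr rfl fun z _ => ?_
        rw [← Finset.mul_sum, Function.Bijective.sum_comp hsq fun y =>
          binarySign (Algebra.trace (ZMod 2) F ((p.2 * z + p.2 ^ 2 * z ^ 4) * y)),
          sum_binarySign_trace_mul]
        split_ifs <;> ring

theorem goldWalsh_eq_or {s : ℤ} (hs : (Fintype.card F : ℤ) = 2 * s ^ 2)
    (hcube : Function.Injective fun x : F => x ^ 3) {p : F × F} (hp : p ≠ 0) :
    goldWalsh p = 0 ∨ goldWalsh p = 2 * s ∨ goldWalsh p = -(2 * s) := by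
  have : CharP F 2 := charP_of_injective_algebraMap (algebraMap (ZMod 2) F).injective 2
  have h2 : (2 : F) = 0 := CharTwo.two_eq_zero
  by_cases hb : p.2 = 0
  · left
    have ha : p.1 ≠ 0 := fun ha => hp (Prod.ext ha hb)
    simp [goldWalsh, goldForm_apply, hb, sum_binarySign_trace_mul, ha]
  obtain ⟨u, hu⟩ := (Finite.injective_iff_surjective.mp hcube) p.2⁻¹
  replace hu : u ^ 3 = p.2⁻¹ := hu
  have hu0 : u ≠ 0 := by
    rintro rfl
    exact inv_ne_zero hb (by rw [← hu]; simp)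
  have hker : ∀ z : F, p.2 * z + p.2 ^ 2 * z ^ 4 = 0 ↔ z ∈ ({0, u} : Finset F) := by
    intro z
    rw [Finset.mem_insert, Finset.mem_singleton]
    constructor
    · intro h
      by_cases hz : z = 0
      · exact Or.inl hz
      · refine Or.inr (hcube ?_)
        change z ^ 3 = u ^ 3
        rw [hu]
        refine eq_inv_of_mul_eq_one_left ?_
        have h' : p.2 * z * (z ^ 3 * p.2 - 1) = 0 := by
          linear_combination h - p.2 * z * h2
        have := (mul_eq_zero.mp h').resolve_left (mul_ne_zero hb hz)
        linear_combination this
    · rintro (rfl | rfl)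
      · simp
      · have : p.2 * z ^ 3 = 1 := by rw [hu, mul_inv_cancel₀ hb]
        linear_combination p.2 * z * this + p.2 * z * h2
  have key := goldWalsh_sq p
  simp_rw [hker] at key
  rw [← Finset.sum_filter, Finset.filter_mem_eq_inter, Finset.univ_inter,
    Finset.sum_pair hu0.symm, goldForm_zero_left, binarySign_zero, hs] at key
  rcases binarySign_eq_or (goldForm u p) with h | h <;> rw [h] at key
  · right
    have : (goldWalsh p - 2 * s) * (goldWalsh p + 2 * s) = 0 := by linear_combination key
    rcases mul_eq_zero.mp this with h | h
    · left; linarith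
    · right; linarith
  · left
    exact pow_eq_zero_iff two_ne_zero |>.mp (by linarith)

theorem sum_goldWalsh : ∑ p : F × F, goldWalsh p = (Fintype.card F : ℤ) ^ 2 := by
  simp_rw [goldWalsh, goldForm_apply]
  rw [Finset.sum_comm]
  simp_rw [sum_binarySign_trace_pair]
  simp

theorem sum_binarySign_goldForm_one :
    ∑ p : F × F, binarySign (goldForm 1 p) = 0 := by
  simp_rw [goldForm_apply, sum_binarySign_trace_pair]
  simp

theorem sum_binarySign_mul_goldWalsh :
    ∑ p : F × F, binarySign (goldForm 1 p) * goldWalsh p = (Fintype.card F : ℤ) ^ 2 := by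
  have : CharP F 2 := charP_of_injective_algebraMap (algebraMap (ZMod 2) F).injective 2
  simp_rw [goldWalsh, Finset.mul_sum, goldForm_apply, ← binarySign_add, ← map_add]
  rw [Finset.sum_comm]
  have h : ∀ (x : F) (p : F × F), p.1 * 1 + p.2 * 1 ^ 3 + (p.1 * x + p.2 * x ^ 3) =
      p.1 * (1 + x) + p.2 * (1 + x ^ 3) := fun x p => by ring
  simp_rw [h, sum_binarySign_trace_pair]
  rw [Finset.sum_eq_single 1]
  · simp [CharTwo.add_self_eq_zero]
  · intro x _ hx
    rw [if_neg]
    exact fun h => hx (CharTwo.add_eq_zero.mp h.1).symm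
  · simp

theorem sum_goldWalsh_sq :
    ∑ p : F × F, goldWalsh p ^ 2 = (Fintype.card F : ℤ) ^ 3 := by
  have : CharP F 2 := charP_of_injective_algebraMap (algebraMap (ZMod 2) F).injective 2
  simp_rw [sq (goldWalsh _), goldWalsh, Finset.sum_mul_sum, goldForm_apply, ← binarySign_add,
    ← map_add]
  rw [Finset.sum_comm]
  have h : ∀ (x y : F) (p : F × F), p.1 * x + p.2 * x ^ 3 + (p.1 * y + p.2 * y ^ 3) =
      p.1 * (x + y) + p.2 * (x ^ 3 + y ^ 3) := fun x y p => by ring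
  have h' : ∀ x : F, ∑ p : F × F, ∑ y : F, binarySign (Algebra.trace (ZMod 2) F
      (p.1 * x + p.2 * x ^ 3 + (p.1 * y + p.2 * y ^ 3))) = (Fintype.card F : ℤ) ^ 2 := by
    intro x
    rw [Finset.sum_comm]
    simp_rw [h, sum_binarySign_trace_pair]
    rw [Finset.sum_eq_single x]
    · simp [CharTwo.add_self_eq_zero]
    · intro y _ hy
      rw [if_neg]
      exact fun h => hy (CharTwo.add_eq_zero.mp h.1).symm
    · simp
  simp_rw [h']
  simp
  ring

theorem sum_binarySign_mul_goldWalsh_sq :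
    ∑ p : F × F, binarySign (goldForm 1 p) * goldWalsh p ^ 2 =
      2 * (Fintype.card F : ℤ) ^ 2 := by
  have : CharP F 2 := charP_of_injective_algebraMap (algebraMap (ZMod 2) F).injective 2
  have h2 : (2 : F) = 0 := CharTwo.two_eq_zero
  simp_rw [sq (goldWalsh _), goldWalsh, Finset.sum_mul_sum, Finset.mul_sum, goldForm_apply,
    ← binarySign_add, ← map_add]
  rw [Finset.sum_comm]
  have h : ∀ (x y : F) (p : F × F),
      p.1 * 1 + p.2 * 1 ^ 3 + (p.1 * x + p.2 * x ^ 3 + (p.1 * y + p.2 * y ^ 3)) =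
      p.1 * (1 + x + y) + p.2 * (1 + x ^ 3 + y ^ 3) := fun x y p => by ring
  have h' : ∀ x : F, ∑ p : F × F, ∑ y : F, binarySign (Algebra.trace (ZMod 2) F
      (p.1 * 1 + p.2 * 1 ^ 3 + (p.1 * x + p.2 * x ^ 3 + (p.1 * y + p.2 * y ^ 3)))) =
      if x ∈ ({0, 1} : Finset F) then (Fintype.card F : ℤ) ^ 2 else 0 := by
    intro x
    rw [Finset.sum_comm]
    simp_rw [h, sum_binarySign_trace_pair]
    rw [Finset.sum_eq_single (1 + x)]
    · refine if_congr ?_ rfl rfl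
      rw [Finset.mem_insert, Finset.mem_singleton]
      constructor
      · rintro ⟨-, hx⟩
        have : x * (x - 1) = 0 := by
          linear_combination hx - (1 + x ^ 3 + x ^ 2 + 2 * x) * h2
        rcases mul_eq_zero.mp this with h | h
        · exact Or.inl h
        · exact Or.inr (by linear_combination h)
      · rintro (rfl | rfl)
        · simp [CharTwo.add_self_eq_zero]
        · constructor
          · linear_combination 2 * h2
          · linear_combination 5 * h2
    · intro y _ hy
      rw [if_neg]
      exact fun h => hy (CharTwo.add_eq_zero.mp h.1).symm
    · simp
  simp_rw [h']
  rw [← Finset.sum_filter, Finset.filter_mem_eq_inter, Finset.univ_inter,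
    Finset.sum_pair zero_ne_one]
  ring

/-- The number of nonzero pairs `p` with `(-1)^(goldForm 1 p) = ε` and `goldWalsh p = v`. -/
noncomputable def goldCount (F : Type) [Field F] [Fintype F] [DecidableEq F]
    [Algebra (ZMod 2) F] (ε v : ℤ) : ℕ :=
  #{p : F × F | p ≠ 0 ∧ binarySign (goldForm 1 p) = ε ∧ goldWalsh p = v}

/-- Summing a polynomial of degree one in the sign and two in the Walsh sum over all nonzero
pairs. -/
theorem sum_goldWalsh_poly (ε a b c : ℤ) :
    ∑ p : F × F with p ≠ 0, (1 + ε * binarySign (goldForm 1 p)) *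
      (a + b * goldWalsh p + c * goldWalsh p ^ 2) =
      a * ((Fintype.card F : ℤ) ^ 2 - 1 - ε)
      + b * (1 + ε) * ((Fintype.card F : ℤ) ^ 2 - Fintype.card F)
      + c * ((Fintype.card F : ℤ) ^ 3 - (Fintype.card F : ℤ) ^ 2
        + ε * (Fintype.card F : ℤ) ^ 2) := by
  have h := Finset.sum_filter_add_sum_filter_not (Finset.univ : Finset (F × F)) (fun p => p ≠ 0)
    fun p => (1 + ε * binarySign (goldForm 1 p)) * (a + b * goldWalsh p + c * goldWalsh p ^ 2)
  have h0 : ({p : F × F | ¬ p ≠ 0} : Finset (F × F)) = {0} := by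
    ext p; simp
  rw [h0, Finset.sum_singleton, goldWalsh_zero, map_zero, binarySign_zero] at h
  have hexp : ∀ p : F × F,
      (1 + ε * binarySign (goldForm 1 p)) * (a + b * goldWalsh p + c * goldWalsh p ^ 2) =
      a + b * goldWalsh p + c * goldWalsh p ^ 2 + (ε * a) * binarySign (goldForm 1 p)
      + (ε * b) * (binarySign (goldForm 1 p) * goldWalsh p)
      + (ε * c) * (binarySign (goldForm 1 p) * goldWalsh p ^ 2) := fun p => by ring
  have hall : ∑ p : F × F,
      (1 + ε * binarySign (goldForm 1 p)) * (a + b * goldWalsh p + c * goldWalsh p ^ 2) =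
      (Fintype.card F : ℤ) ^ 2 * a + b * (Fintype.card F : ℤ) ^ 2
      + c * (Fintype.card F : ℤ) ^ 3 + ε * b * (Fintype.card F : ℤ) ^ 2
      + ε * c * (2 * (Fintype.card F : ℤ) ^ 2) := by
    simp_rw [hexp, Finset.sum_add_distrib, ← Finset.mul_sum]
    rw [sum_goldWalsh, sum_goldWalsh_sq, sum_binarySign_goldForm_one,
      sum_binarySign_mul_goldWalsh, sum_binarySign_mul_goldWalsh_sq]
    rw [Finset.sum_const, Finset.card_univ, Fintype.card_prod, nsmul_eq_mul]
    push_cast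
    ring
  rw [hall] at h
  linear_combination h

theorem goldCount_zero {s : ℤ} (hs0 : 0 < s) (hs : (Fintype.card F : ℤ) = 2 * s ^ 2)
    (hcube : Function.Injective fun x : F => x ^ 3) {ε : ℤ} (hε : ε = 1 ∨ ε = -1) :
    (2 * goldCount F ε 0 : ℤ) = 2 * s ^ 4 - 1 - ε + s ^ 2 * (1 - ε) := by
  have key := sum_goldWalsh_poly (F := F) ε (4 * s ^ 2) 0 (-1)
  have hcount : ∑ p : F × F with p ≠ 0, (1 + ε * binarySign (goldForm 1 p)) *
      (4 * s ^ 2 + 0 * goldWalsh p + (-1) * goldWalsh p ^ 2) =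
      8 * s ^ 2 * goldCount F ε 0 := by
    rw [goldCount, Finset.card_filter, Finset.sum_filter, Nat.cast_sum, Finset.mul_sum]
    refine Finset.sum_congr rfl fun p _ => ?_
    by_cases hp : p = 0
    · simp [hp]
    rcases hε with rfl | rfl <;>
    rcases binarySign_eq_or (goldForm 1 p) with h1 | h1 <;>
    rcases goldWalsh_eq_or hs hcube hp with h | h | h <;>
    · simp [hp, h, h1, hs0.ne'] <;> try ring
  rw [hcount, hs] at key
  refine mul_left_cancel₀ (pow_ne_zero 2 hs0.ne') ?_
  linarith

theorem goldCount_ne_zero {s v : ℤ} (hs0 : 0 < s) (hs : (Fintype.card F : ℤ) = 2 * s ^ 2)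
    (hcube : Function.Injective fun x : F => x ^ 3) {ε : ℤ} (hε : ε = 1 ∨ ε = -1)
    (hv : v = 2 * s ∨ v = -(2 * s)) :
    (8 * goldCount F ε v : ℤ) =
      v * (1 + ε) * (2 * s ^ 2 - 1) + 2 * s ^ 2 * (2 * s ^ 2 - 1 + ε) := by
  have key := sum_goldWalsh_poly (F := F) ε 0 v 1
  have hcount : ∑ p : F × F with p ≠ 0, (1 + ε * binarySign (goldForm 1 p)) *
      (0 + v * goldWalsh p + 1 * goldWalsh p ^ 2) = 16 * s ^ 2 * goldCount F ε v := by
    rw [goldCount, Finset.card_filter, Finset.sum_filter, Nat.cast_sum, Finset.mul_sum]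
    refine Finset.sum_congr rfl fun p _ => ?_
    have hne : ¬ (-(2 * s) = 2 * s) := by omega
    have hne' : ¬ (2 * s = -(2 * s)) := by omega
    by_cases hp : p = 0
    · simp [hp]
    rcases hε with rfl | rfl <;> rcases hv with rfl | rfl <;>
    rcases binarySign_eq_or (goldForm 1 p) with h1 | h1 <;>
    rcases goldWalsh_eq_or hs hcube hp with h | h | h <;>
    · simp [hp, h, h1, hs0.ne', hne, hne'] <;> try ring
  rw [hcount, hs] at key
  refine mul_left_cancel₀ (pow_ne_zero 2 hs0.ne') ?_
  linarith

theorem two_mul_hammingNorm {ι : Type*} [Fintype ι] (c : ι → ZMod 2) :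
    (2 * hammingNorm c : ℤ) = ∑ i, (1 - binarySign (c i)) := by
  rw [hammingNorm, Finset.card_filter, Nat.cast_sum, Finset.mul_sum]
  refine Finset.sum_congr rfl fun i _ => ?_
  generalize c i = t
  revert t; decide

/-- List all nonzero elements of `F` once, and `1` another `k` times: the weight of the resulting
codeword is determined by the Walsh sum and the sign at `1`. -/
theorem exists_points_two_mul_hammingNorm {k L : ℕ} (hL : L + 1 = Fintype.card F + k) :
    ∃ pts : Fin L → F, (∀ x ≠ 0, ∃ i, pts i = x) ∧ ∀ p : F × F,
      (2 * hammingNorm (fun i => goldForm (pts i) p) : ℤ) =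
        Fintype.card F - goldWalsh p + k * (1 - binarySign (goldForm 1 p)) := by
  have hcard : Fintype.card (Fin L) = Fintype.card ({x : F // x ≠ 0} ⊕ Fin k) := by
    rw [Fintype.card_sum, Fintype.card_fin, Fintype.card_fin, Fintype.card_subtype_compl,
      Fintype.card_subtype_eq]
    have := Fintype.card_pos (α := F)
    omega
  let e := Fintype.equivOfCardEq hcard
  refine ⟨fun i => Sum.elim (fun x : {x : F // x ≠ 0} => x.1) (fun _ => 1) (e i),
    fun x hx => ⟨e.symm (Sum.inl ⟨x, hx⟩), by simp⟩, fun p => ?_⟩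
  rw [two_mul_hammingNorm, Equiv.sum_comp e fun j => 1 - binarySign
    (goldForm (Sum.elim (fun x : {x : F // x ≠ 0} => x.1) (fun _ => 1) j) p),
    Fintype.sum_sum_type]
  congr 1
  · have h := Fintype.sum_subtype_add_sum_subtype (fun x : F => x ≠ 0)
      fun x => 1 - binarySign (goldForm x p)
    have h0 : ∑ x : {x : F // ¬ x ≠ 0}, (1 - binarySign (goldForm x.1 p)) = 0 := by
      refine Finset.sum_eq_zero fun x _ => ?_
      rw [not_not.mp x.2, goldForm_zero_left, binarySign_zero, sub_self]
    rw [h0, add_zero] at h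
    refine h.trans ?_
    simp [goldWalsh]
  · simp [mul_sub]

/-- The number of pairs whose weight `wt p` is `w`, when `wt` is determined on nonzero pairs by the
sign at `1` and the Walsh sum. -/
theorem card_filter_eq_sum_goldCount {s : ℤ} (hs0 : 0 < s)
    (hs : (Fintype.card F : ℤ) = 2 * s ^ 2) (hcube : Function.Injective fun x : F => x ^ 3)
    (wt : F × F → ℕ) (g : ℤ → ℤ → ℕ) (h0 : wt 0 = 0)
    (hwt : ∀ p ≠ 0, wt p = g (binarySign (goldForm 1 p)) (goldWalsh p)) (w : ℕ) :
    #{p : F × F | wt p = w} = (if 0 = w then 1 else 0)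
      + ((if g 1 (2 * s) = w then goldCount F 1 (2 * s) else 0)
      + ((if g 1 0 = w then goldCount F 1 0 else 0)
      + ((if g 1 (-(2 * s)) = w then goldCount F 1 (-(2 * s)) else 0)
      + ((if g (-1) (2 * s) = w then goldCount F (-1) (2 * s) else 0)
      + ((if g (-1) 0 = w then goldCount F (-1) 0 else 0)
      + (if g (-1) (-(2 * s)) = w then goldCount F (-1) (-(2 * s)) else 0)))))) := by
  have hne : ¬ (-(2 * s) = 2 * s) := by omega
  have hne' : ¬ (2 * s = -(2 * s)) := by omega
  have hzero : (if 0 = w then 1 else 0) = ∑ p : F × F, if p = 0 ∧ 0 = w then 1 else 0 := by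
    rw [Finset.sum_eq_single 0] <;> simp +contextual
  have hclass : ∀ ε v : ℤ, (if g ε v = w then goldCount F ε v else 0) = ∑ p : F × F,
      if (p ≠ 0 ∧ binarySign (goldForm 1 p) = ε ∧ goldWalsh p = v) ∧ g ε v = w then 1 else 0 := by
    intro ε v
    by_cases h : g ε v = w
    · simp only [h, and_true, if_true]
      rw [goldCount, Finset.card_filter]
    · simp [h]
  rw [Finset.card_filter]
  simp only [hzero, hclass]
  simp only [← Finset.sum_add_distrib]
  refine Finset.sum_congr rfl fun p _ => ?_
  by_cases hp : p = 0
  · simp [hp, h0]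
  rw [hwt p hp]
  rcases binarySign_eq_or (goldForm 1 p) with h1 | h1 <;>
  rcases goldWalsh_eq_or hs hcube hp with h | h | h <;>
  simp [hp, h, h1, hs0.ne', hne, hne']

/-- The dual of the double-error-correcting BCH code with the coordinate at `1` repeated `k` more
times. -/
theorem exists_minimal_goldCode {r k L : ℕ} (hr : 2 ≤ r) (hF : Fintype.card F = 8 * r ^ 2)
    (hcube : Function.Injective fun x : F => x ^ 3) (hk : k + 6 * r = 4 * r ^ 2)
    (hL : L + 1 = Fintype.card F + k) :
    ∃ C : Submodule (ZMod 2) (Fin L → ZMod 2),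
      Module.finrank (ZMod 2) C = 2 * Module.finrank (ZMod 2) F ∧ IsMinimalCode C ∧
      ∀ w : ℕ, Aw C w = (if 0 = w then 1 else 0)
        + ((if 4 * r ^ 2 - 2 * r = w then (4 * r ^ 2 + 2 * r - 1) * (2 * r ^ 2 + r) else 0)
        + ((if 4 * r ^ 2 = w then (4 * r ^ 2 - 1) * (4 * r ^ 2 + 1) else 0)
        + ((if 4 * r ^ 2 + 2 * r = w then (4 * r ^ 2 - 2 * r - 1) * (2 * r ^ 2 - r) else 0)
        + ((if 8 * r ^ 2 - 8 * r = w then (4 * r ^ 2 - 2 * r) * (2 * r ^ 2 + r) else 0)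
        + ((if 8 * r ^ 2 - 6 * r = w then 4 * r ^ 2 * (4 * r ^ 2 + 1) else 0)
        + (if 8 * r ^ 2 - 4 * r = w then (4 * r ^ 2 + 2 * r) * (2 * r ^ 2 - r) else 0)))))) := by
  obtain ⟨pts, hpts, hwt⟩ := exists_points_two_mul_hammingNorm hL
  have hrr : 2 * r ≤ r ^ 2 := by nlinarith
  have hs : (Fintype.card F : ℤ) = 2 * (2 * r) ^ 2 := by rw [hF]; push_cast; ring
  have hs0 : (0 : ℤ) < 2 * r := by omega
  let φ : F × F →ₗ[ZMod 2] (Fin L → ZMod 2) := LinearMap.pi fun i => goldForm (pts i)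
  have hφ : ∀ p i, φ p i = goldForm (pts i) p := fun _ _ => rfl
  have hsupp : ∀ p p' : F × F, (∀ i, φ p' i ≠ 0 → φ p i ≠ 0) →
      ∀ x : F, goldForm x p' ≠ 0 → goldForm x p ≠ 0 := by
    intro p p' h x hx
    by_cases hx0 : x = 0
    · simp [hx0, goldForm_zero_left] at hx
    · obtain ⟨i, rfl⟩ := hpts x hx0
      exact h i hx
  have hinj : Function.Injective φ := by
    rw [injective_iff_map_eq_zero]
    intro p hp
    by_contra hp0
    have h := hwt p
    have hn : hammingNorm (fun i => goldForm (pts i) p) = 0 := hammingNorm_eq_zero.mpr hp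
    have h1 := goldWalsh_eq_of_support_subset (p := 0) (p' := p)
      (hsupp 0 p fun i hi => by simp [hp] at hi)
    rw [goldWalsh_zero, zero_sub, hs] at h1
    have hrr' : (2 * r : ℤ) ≤ r ^ 2 := mod_cast hrr
    rcases goldWalsh_eq_or hs hcube hp0 with h | h | h <;>
    rcases goldWalsh_eq_or hs hcube (neg_ne_zero.mpr hp0) with h' | h' | h' <;>
    rw [h, h'] at h1 <;> nlinarith
  refine ⟨LinearMap.range φ, ?_, ?_, ?_⟩
  · rw [LinearMap.finrank_range_of_inj hinj, Module.finrank_prod]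
    ring
  · rintro _ ⟨p, rfl⟩ - _ ⟨p', rfl⟩ hsub
    by_cases hp' : p' = 0
    · exact ⟨0, by simp [hp']⟩
    by_cases hpp : p - p' = 0
    · exact ⟨1, by rw [sub_eq_zero.mp hpp, one_smul]⟩
    exfalso
    have h1 := goldWalsh_eq_of_support_subset (hsupp p p' fun i hi => hsub hi)
    have hp : p ≠ 0 := by
      rintro rfl
      refine hp' (hinj ?_)
      ext i
      by_contra hi
      rw [map_zero] at hi
      exact hsub hi (by simp)
    rw [hs] at h1
    have hrr' : (2 * r : ℤ) ≤ r ^ 2 := mod_cast hrr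
    have h := goldWalsh_eq_or hs hcube hp
    have h' := goldWalsh_eq_or hs hcube hp'
    have h'' := goldWalsh_eq_or hs hcube hpp
    ring_nf at h1 hrr' h h' h''
    omega
  · intro w
    have hcard : Aw (LinearMap.range φ) w = #{p : F × F | hammingNorm (φ p) = w} := by
      have hset : {c | c ∈ LinearMap.range φ ∧ hammingNorm c = w} =
          φ '' ({p : F × F | hammingNorm (φ p) = w} : Finset (F × F)) := by
        ext c
        simp only [LinearMap.mem_range, Set.mem_ofPred_eq, Finset.coe_filter, Finset.mem_univ,
          true_and, Set.mem_image]
        constructor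
        · rintro ⟨⟨p, rfl⟩, hp⟩
          exact ⟨p, hp, rfl⟩
        · rintro ⟨p, hp, rfl⟩
          exact ⟨⟨p, rfl⟩, hp⟩
      rw [Aw, hset, Set.ncard_image_of_injective _ hinj, Set.ncard_coe_finset]
    have hval : ∀ p : F × F, hammingNorm (φ p) = ((Fintype.card F - goldWalsh p
        + k * (1 - binarySign (goldForm 1 p))) / 2).toNat := by
      intro p
      have := hwt p
      change (2 * hammingNorm (φ p) : ℤ) = _ at this
      omega
    rw [hcard, card_filter_eq_sum_goldCount hs0 hs hcube (fun p => hammingNorm (φ p))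
      (fun ε v => ((Fintype.card F - v + k * (1 - ε)) / 2).toNat) (by simp) (fun p _ => hval p)]
    have e1 := goldCount_ne_zero (ε := 1) hs0 hs hcube (.inl rfl) (.inl rfl)
    have e2 := goldCount_zero (ε := 1) hs0 hs hcube (.inl rfl)
    have e3 := goldCount_ne_zero (ε := 1) hs0 hs hcube (.inl rfl) (.inr rfl)
    have e4 := goldCount_ne_zero (ε := -1) hs0 hs hcube (.inr rfl) (.inl rfl)
    have e5 := goldCount_zero (ε := -1) hs0 hs hcube (.inr rfl)
    have e6 := goldCount_ne_zero (ε := -1) hs0 hs hcube (.inr rfl) (.inr rfl)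
    have hk' : (k : ℤ) = 4 * r ^ 2 - 6 * r := by rw [eq_sub_iff_add_eq]; exact_mod_cast hk
    have c1 : 1 ≤ 4 * r ^ 2 + 2 * r := by omega
    have c2 : 1 ≤ 4 * r ^ 2 := by omega
    have c3 : 2 * r ≤ 4 * r ^ 2 := by omega
    have c4 : 1 ≤ 4 * r ^ 2 - 2 * r := by omega
    have c5 : r ≤ 2 * r ^ 2 := by omega
    congr 1
    congr 1
    · refine if_congr (by rw [hF]; omega) ?_ rfl
      zify [c1]; linarith
    congr 1
    · refine if_congr (by rw [hF]; omega) ?_ rfl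
      zify [c2]; linarith
    congr 1
    · refine if_congr (by rw [hF]; omega) ?_ rfl
      zify [c3, c4, c5]; linarith
    congr 1
    · refine if_congr (by rw [hF]; omega) ?_ rfl
      zify [c3]; linarith
    congr 1
    · refine if_congr (by rw [hF]; omega) ?_ rfl
      zify; linarith
    · refine if_congr (by rw [hF]; omega) ?_ rfl
      zify [c5]; linarith

end GoldForm

theorem cube_injective_of_card {F : Type*} [Field F] [Fintype F] {j : ℕ}
    (hF : Fintype.card F = 2 ^ (2 * j + 1)) : Function.Injective fun x : F => x ^ 3 := by
  obtain ⟨t, ht⟩ : ∃ t, Fintype.card F - 1 = 3 * t + 1 := by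
    have h : 2 ^ (2 * j + 1) % 3 = 2 := by
      rw [pow_succ, pow_mul, Nat.mul_mod, Nat.pow_mod]; simp
    exact ⟨2 ^ (2 * j + 1) / 3, by omega⟩
  intro x y h
  replace h : x ^ 3 = y ^ 3 := h
  by_cases hy : y = 0
  · subst hy
    simpa using h
  have hx : x ≠ 0 := by
    rintro rfl
    exact pow_ne_zero 3 hy (by simpa using h.symm)
  have hpow : ∀ z : F, z ≠ 0 → (z ^ 3) ^ t * z = 1 := fun z hz => by
    rw [← pow_mul, ← pow_succ, ← ht, FiniteField.pow_card_sub_one_eq_one z hz]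
  have h1 := hpow x hx
  rw [h, ← hpow y hy] at h1
  exact mul_left_cancel₀ (pow_ne_zero _ (pow_ne_zero _ hy)) h1

theorem List.sum_map_snd_filter (l : List (ℕ × ℕ)) (w : ℕ) :
    ((l.filter fun p => p.1 == w).map Prod.snd).sum =
      (l.map fun p => if p.1 = w then p.2 else 0).sum := by
  induction l with
  | nil => rfl
  | cons p l ih =>
    by_cases h : p.1 = w <;> simp [h, ih]

theorem exists_mem_of_Aw_pos {n w : ℕ} {C : Submodule (ZMod 2) (Fin n → ZMod 2)}
    (h : 0 < Aw C w) : ∃ c ∈ C, hammingNorm c = w :=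
  (Set.ncard_pos (Set.toFinite _)).mp h

theorem Aw_hammingNorm_pos {n : ℕ} {C : Submodule (ZMod 2) (Fin n → ZMod 2)}
    {c : Fin n → ZMod 2} (hc : c ∈ C) : 0 < Aw C (hammingNorm c) :=
  (Set.ncard_pos (Set.toFinite _)).mpr ⟨c, hc, rfl⟩

/-- Proposition 6.2. Minimal codes violating the Ashikhmin-Barg condition from
duals of primitive BCH codes, with explicit weight distribution. -/
theorem minimal_code_from_BCH_dual_weight_distribution
    {m : ℕ} (hm : 5 ≤ m) (hodd : Odd m)
    (n' : ℕ) (hn' : n' = 2 ^ (m - 1) - 3 * 2 ^ ((m - 1) / 2)) :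
    ∃ C' : Submodule (ZMod 2) (Fin (2 ^ m + n' - 1) → ZMod 2),
      Module.finrank (ZMod 2) C' = 2 * m ∧
      wmin C' = 2 ^ (m - 1) - 2 ^ ((m - 1) / 2) ∧
      IsMinimalCode C' ∧
      2 * wmin C' ≤ (2 - 1) * wmax C' ∧
      (∀ w : ℕ, Aw C' w =
        ((([
          ((0 : ℕ), (1 : ℕ)),
          (2 ^ (m - 1) - 2 ^ ((m - 1) / 2),
            (2 ^ (m - 1) + 2 ^ ((m - 1) / 2) - 1) * (2 ^ (m - 2) + 2 ^ ((m - 3) / 2))),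
          (2 ^ (m - 1), (2 ^ (m - 1) - 1) * (2 ^ (m - 1) + 1)),
          (2 ^ (m - 1) + 2 ^ ((m - 1) / 2),
            (2 ^ (m - 1) - 2 ^ ((m - 1) / 2) - 1) * (2 ^ (m - 2) - 2 ^ ((m - 3) / 2))),
          (2 ^ m - 2 ^ ((m + 3) / 2),
            (2 ^ (m - 1) - 2 ^ ((m - 1) / 2)) * (2 ^ (m - 2) + 2 ^ ((m - 3) / 2))),
          (2 ^ m - 3 * 2 ^ ((m - 1) / 2), 2 ^ (m - 1) * (2 ^ (m - 1) + 1)),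
          (2 ^ m - 2 ^ ((m + 1) / 2),
            (2 ^ (m - 1) + 2 ^ ((m - 1) / 2)) * (2 ^ (m - 2) - 2 ^ ((m - 3) / 2)))
        ] : List (ℕ × ℕ)).filter (fun p => p.1 == w)).map Prod.snd).sum) := by
  obtain ⟨j, rfl⟩ := hodd
  obtain ⟨i, rfl⟩ : ∃ i, j = i + 1 := ⟨j - 1, by omega⟩
  obtain ⟨r, hr⟩ : ∃ r, r = 2 ^ i := ⟨_, rfl⟩
  have hr2 : 2 ≤ r := by
    rw [hr]
    exact Nat.le_self_pow (by omega) 2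
  have hrr : 2 * r ≤ r ^ 2 := by nlinarith
  have p0 : 2 ^ (2 * (i + 1) + 1) = 8 * r ^ 2 := by rw [hr]; ring
  have p1 : 2 ^ (2 * (i + 1) + 1 - 1) = 4 * r ^ 2 := by
    rw [hr, Nat.add_sub_cancel]; ring
  have p2 : 2 ^ (2 * (i + 1) + 1 - 2) = 2 * r ^ 2 := by
    rw [hr, show 2 * (i + 1) + 1 - 2 = 2 * i + 1 by omega]; ring
  have p3 : 2 ^ ((2 * (i + 1) + 1 - 1) / 2) = 2 * r := by
    rw [hr, show (2 * (i + 1) + 1 - 1) / 2 = i + 1 by omega]; ring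
  have p4 : 2 ^ ((2 * (i + 1) + 1 - 3) / 2) = r := by
    rw [hr, show (2 * (i + 1) + 1 - 3) / 2 = i by omega]
  have p5 : 2 ^ ((2 * (i + 1) + 1 + 3) / 2) = 8 * r := by
    rw [hr, show (2 * (i + 1) + 1 + 3) / 2 = i + 3 by omega]; ring
  have p6 : 2 ^ ((2 * (i + 1) + 1 + 1) / 2) = 4 * r := by
    rw [hr, show (2 * (i + 1) + 1 + 1) / 2 = i + 2 by omega]; ring
  classical
  let F := GaloisField 2 (2 * (i + 1) + 1)
  let _ : Fintype F := Fintype.ofFinite F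
  have hF : Fintype.card F = 2 ^ (2 * (i + 1) + 1) := by
    rw [← Nat.card_eq_fintype_card]
    exact GaloisField.card 2 _ (by omega)
  have hfin : Module.finrank (ZMod 2) F = 2 * (i + 1) + 1 := GaloisField.finrank 2 (by omega)
  rw [p1, p3] at hn'
  obtain ⟨C, hrank, hmin, hA⟩ := exists_minimal_goldCode (F := F) (r := r) (k := n')
    (L := 2 ^ (2 * (i + 1) + 1) + n' - 1) hr2 (hF.trans p0) (cube_injective_of_card hF)
    (by omega) (by rw [hF]; omega)
  have hwmin : wmin C = 4 * r ^ 2 - 2 * r := by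
    refine IsLeast.csInf_eq ⟨?_, ?_⟩
    · obtain ⟨c, hc, hcw⟩ := exists_mem_of_Aw_pos (C := C) (w := 4 * r ^ 2 - 2 * r) (by
        have : 0 < (4 * r ^ 2 + 2 * r - 1) * (2 * r ^ 2 + r) :=
          Nat.mul_pos (by omega) (by omega)
        rw [hA, if_pos (rfl : 4 * r ^ 2 - 2 * r = _)]
        omega)
      refine ⟨c, hc, ?_, hcw⟩
      rintro rfl
      rw [hammingNorm_zero] at hcw
      omega
    · rintro _ ⟨c, hc, hc0, rfl⟩
      have hpos := Aw_hammingNorm_pos hc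
      have hne : hammingNorm c ≠ 0 := hammingNorm_ne_zero_iff.mpr hc0
      by_contra! hlt
      rw [hA] at hpos
      repeat rw [if_neg (by omega)] at hpos
      exact lt_irrefl _ hpos
  have hwmax : 8 * r ^ 2 - 4 * r ≤ wmax C := by
    refine le_csSup ⟨2 ^ (2 * (i + 1) + 1) + n' - 1, ?_⟩ (exists_mem_of_Aw_pos ?_)
    · rintro _ ⟨c, -, rfl⟩
      simpa using hammingNorm_le_card_fintype (x := c)
    · have : 0 < (4 * r ^ 2 + 2 * r) * (2 * r ^ 2 - r) := Nat.mul_pos (by omega) (by omega)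
      rw [hA, if_pos (rfl : 8 * r ^ 2 - 4 * r = _)]
      omega
  refine ⟨C, ?_, ?_, hmin, ?_, fun w => ?_⟩
  · rw [hrank, hfin]
  · rw [hwmin, p1, p3]
  · rw [hwmin]
    omega
  · rw [List.sum_map_snd_filter, hA, p0, p1, p2, p3, p4, p5, p6]
    simp only [List.map_cons, List.map_nil, List.sum_cons, List.sum_nil, add_zero]
    simp only [show 3 * (2 * r) = 6 * r by ring]
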